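/- arXiv:2412.01995 — 2 statements merged into one kernel-verified Lean document; each statement's English description precedes it below -/
import Mathlib

section
/- For every x in the open subprobability simplex Δ one has 1/(d+1) ≤ det(½∇²w(x)) / e^{w(x)} ≤ 1; in particular, det(½∇²w(x)) / e^{w(x)} = ∑_{i=1}^d x_i² + (1 − ∑_{i=1}^d x_i)². Consequently w is a smooth supersolution and w − log(d+1) a smooth subsolution of the equation g = log det(½∇²g) on Δ. -/
open Real Filter MeasureTheory
open scoped Matrix

noncomputable section

/-- The open subprobability simplex in `ℝ^d`. -/
def simplexΔ (d : ℕ) : Set (Fin d → ℝ) := {x | (∀ i, 0 < x i) ∧ ∑ i, x i < 1}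

/-- Hessian matrix of `u` at `x` (entries `∂²u/∂xᵢ∂xⱼ`). -/
def hess (d : ℕ) (u : (Fin d → ℝ) → ℝ) (x : Fin d → ℝ) : Matrix (Fin d) (Fin d) ℝ :=
  Matrix.of fun i j => fderiv ℝ (fun y => fderiv ℝ u y (Pi.single j 1)) x (Pi.single i 1)

/-- The barrier function `w(x) = -2∑ log xᵢ - 2 log(1-∑xᵢ)`. -/
def wbar (d : ℕ) (x : Fin d → ℝ) : ℝ :=
  -2 * ∑ i, Real.log (x i) - 2 * Real.log (1 - ∑ i, x i)

/-- Gradient of `u` at `x`. -/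
def gradv (d : ℕ) (u : (Fin d → ℝ) → ℝ) (x : Fin d → ℝ) : Fin d → ℝ :=
  fun i => fderiv ℝ u x (Pi.single i 1)

theorem isOpen_simplexΔ (d : ℕ) : IsOpen (simplexΔ d) := by
  have h : simplexΔ d = (⋂ i, {x | 0 < x i}) ∩ {x | ∑ i, x i < 1} := by
    ext x
    simp [simplexΔ]
  rw [h]
  exact (isOpen_iInter_of_finite fun i => isOpen_lt continuous_const (continuous_apply i)).inter
    (isOpen_lt (continuous_finsetSum _ fun i _ => continuous_apply i) continuous_const)

theorem hasFDerivAt_one_sub_sum {d : ℕ} (x : Fin d → ℝ) :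
    HasFDerivAt (fun y : Fin d → ℝ => 1 - ∑ i, y i)
      (-∑ i, ContinuousLinearMap.proj (R := ℝ) (φ := fun _ : Fin d => ℝ) i) x :=
  (HasFDerivAt.fun_sum fun i _ => hasFDerivAt_apply i x).const_sub 1

theorem fderiv_wbar {d : ℕ} {x : Fin d → ℝ} (hx : x ∈ simplexΔ d) (j : Fin d) :
    fderiv ℝ (wbar d) x (Pi.single j 1) = -2 * (x j)⁻¹ + 2 * (1 - ∑ i, x i)⁻¹ := by
  have hs : 1 - ∑ i, x i ≠ 0 := (sub_pos.2 hx.2).ne'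
  have h : HasFDerivAt (wbar d) _ x :=
    ((HasFDerivAt.fun_sum fun i (_ : i ∈ Finset.univ) =>
      (hasFDerivAt_apply i x).log (hx.1 i).ne').const_mul (-2)).sub
      (((hasFDerivAt_one_sub_sum x).log hs).const_mul 2)
  rw [h.fderiv]
  simp [Pi.single_apply]

theorem hess_wbar {d : ℕ} {x : Fin d → ℝ} (hx : x ∈ simplexΔ d) (i j : Fin d) :
    hess d (wbar d) x i j
      = (if i = j then 2 * (x j ^ 2)⁻¹ else 0) + 2 * ((1 - ∑ k, x k) ^ 2)⁻¹ := by
  have hs : 1 - ∑ i, x i ≠ 0 := (sub_pos.2 hx.2).ne'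
  have hloc : (fun y => fderiv ℝ (wbar d) y (Pi.single j 1)) =ᶠ[nhds x]
      fun y => -2 * (y j)⁻¹ + 2 * (1 - ∑ k, y k)⁻¹ := by
    filter_upwards [(isOpen_simplexΔ d).mem_nhds hx] with y hy using fderiv_wbar hy j
  have h : HasFDerivAt (fun y : Fin d → ℝ => -2 * (y j)⁻¹ + 2 * (1 - ∑ k, y k)⁻¹) _ x :=
    ((((hasDerivAt_inv (hx.1 j).ne').comp_hasFDerivAt x (hasFDerivAt_apply j x)).const_mul
      (-2)).add (((hasDerivAt_inv hs).comp_hasFDerivAt x (hasFDerivAt_one_sub_sum x)).const_mul 2))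
  rw [hess, Matrix.of_apply, hloc.fderiv_eq, h.fderiv]
  simp [Pi.single_apply, eq_comm]

theorem det_half_hess_wbar {d : ℕ} {x : Fin d → ℝ} (hx : x ∈ simplexΔ d) :
    ((2 : ℝ)⁻¹ • hess d (wbar d) x).det
      = (∏ i, (x i ^ 2)⁻¹) * (1 + (∑ i, x i ^ 2) / (1 - ∑ i, x i) ^ 2) := by
  have h : (2 : ℝ)⁻¹ • hess d (wbar d) x = Matrix.diagonal (fun i => (x i ^ 2)⁻¹) *
      (1 + Matrix.replicateCol Unit (fun i => x i ^ 2) *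
        Matrix.replicateRow Unit (fun _ => ((1 - ∑ k, x k) ^ 2)⁻¹)) := by
    ext i j
    have hi := (hx.1 i).ne'
    rw [Matrix.diagonal_mul, Matrix.smul_apply, hess_wbar hx, smul_eq_mul, Matrix.add_apply,
      Matrix.one_apply, mul_add]
    rcases eq_or_ne i j with rfl | hij
    · simp [Matrix.mul_apply, hi, mul_add]
    · simp [Matrix.mul_apply, hi, hij]
  rw [h, Matrix.det_mul, Matrix.det_diagonal, Matrix.det_one_add_replicateCol_mul_replicateRow,
    dotProduct, ← Finset.mul_sum, div_eq_inv_mul]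

theorem exp_wbar {d : ℕ} {x : Fin d → ℝ} (hx : x ∈ simplexΔ d) :
    Real.exp (wbar d x) = (∏ i, (x i ^ 2)⁻¹) * ((1 - ∑ i, x i) ^ 2)⁻¹ := by
  have key : ∀ t : ℝ, 0 < t → Real.exp (-2 * Real.log t) = (t ^ 2)⁻¹ := fun t ht => by
    rw [show -2 * Real.log t = -Real.log (t ^ 2) by rw [Real.log_pow]; push_cast; ring,
      Real.exp_neg, Real.exp_log (by positivity)]
  rw [wbar, Finset.mul_sum, sub_eq_add_neg, ← neg_mul, Real.exp_add, Real.exp_sum,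
    key _ (sub_pos.2 hx.2)]
  congr 1
  exact Finset.prod_congr rfl fun i _ => key _ (hx.1 i)

theorem one_div_le_sum_sq_add_sq {d : ℕ} (x : Fin d → ℝ) :
    1 / ((d : ℝ) + 1) ≤ ∑ i, x i ^ 2 + (1 - ∑ i, x i) ^ 2 := by
  have h := sq_sum_le_card_mul_sum_sq (s := Finset.univ)
    (f := Fin.snoc (α := fun _ => ℝ) x (1 - ∑ i, x i))
  simp only [Fin.sum_univ_castSucc, Fin.snoc_castSucc, Fin.snoc_last, Finset.card_univ,
    Fintype.card_fin, add_sub_cancel, one_pow, Nat.cast_add, Nat.cast_one] at h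
  rwa [div_le_iff₀' (by positivity)]

theorem sum_sq_add_sq_le_one {d : ℕ} {x : Fin d → ℝ} (hx : x ∈ simplexΔ d) :
    ∑ i, x i ^ 2 + (1 - ∑ i, x i) ^ 2 ≤ 1 := by
  have hnn : 0 ≤ ∑ i, x i := Finset.sum_nonneg fun i _ => (hx.1 i).le
  have h : ∑ i, x i ^ 2 ≤ ∑ i, x i := Finset.sum_le_sum fun i hi => by
    have : x i ≤ ∑ k, x k := Finset.single_le_sum (fun k _ => (hx.1 k).le) hi
    nlinarith [hx.1 i, hx.2]
  nlinarith [hx.2]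

/-- The barrier function is a supersolution and `w - log(d+1)` a subsolution of the
Monge–Ampère equation on the simplex. -/
theorem barrier_sub_supersolution (d : ℕ) (hd : 1 ≤ d) (x : Fin d → ℝ)
    (hx : x ∈ simplexΔ d) :
    ((2 : ℝ)⁻¹ • hess d (wbar d) x).det / Real.exp (wbar d x)
        = ∑ i, x i ^ 2 + (1 - ∑ i, x i) ^ 2 ∧
    1 / ((d : ℝ) + 1) ≤ ((2 : ℝ)⁻¹ • hess d (wbar d) x).det / Real.exp (wbar d x) ∧
    ((2 : ℝ)⁻¹ • hess d (wbar d) x).det / Real.exp (wbar d x) ≤ 1 ∧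
    Real.log (((2 : ℝ)⁻¹ • hess d (wbar d) x).det) ≤ wbar d x ∧
    wbar d x - Real.log ((d : ℝ) + 1)
        ≤ Real.log (((2 : ℝ)⁻¹ • hess d (wbar d) x).det) := by
  have hs : 1 - ∑ i, x i ≠ 0 := (sub_pos.2 hx.2).ne'
  have hP : ∏ i, (x i ^ 2)⁻¹ ≠ 0 :=
    Finset.prod_ne_zero_iff.2 fun i _ => inv_ne_zero (pow_ne_zero 2 (hx.1 i).ne')
  have heq : ((2 : ℝ)⁻¹ • hess d (wbar d) x).det / Real.exp (wbar d x)
      = ∑ i, x i ^ 2 + (1 - ∑ i, x i) ^ 2 := by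
    rw [det_half_hess_wbar hx, exp_wbar hx, mul_div_mul_left _ _ hP]
    field_simp
    ring
  have hlow := one_div_le_sum_sq_add_sq x
  have hup := sum_sq_add_sq_le_one hx
  have hd0 : (0 : ℝ) < d + 1 := by positivity
  have hpos : 0 < ∑ i, x i ^ 2 + (1 - ∑ i, x i) ^ 2 := lt_of_lt_of_le (by positivity) hlow
  have hlog : Real.log ((2 : ℝ)⁻¹ • hess d (wbar d) x).det
      = Real.log (∑ i, x i ^ 2 + (1 - ∑ i, x i) ^ 2) + wbar d x := by
    rw [(div_eq_iff (Real.exp_ne_zero _)).1 heq, Real.log_mul hpos.ne' (Real.exp_ne_zero _),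
      Real.log_exp]
  refine ⟨heq, heq ▸ hlow, heq ▸ hup, ?_, ?_⟩
  · rw [hlog]
    linarith [Real.log_nonpos hpos.le hup]
  · have := Real.log_le_log (by positivity) hlow
    rw [one_div, Real.log_inv] at this
    rw [hlog]
    linarith
end
end

section
/- If g is a C^∞ function on Δ with everywhere positive definite Hessian satisfying g(x) = log det(½∇²g(x)) for all x ∈ Δ and g(x) → +∞ as x approaches any boundary point of Δ, then w(x) − log(d+1) ≤ g(x) ≤ w(x) for all x ∈ Δ, where w(x) := −2 ∑_{i=1}^d log(x_i) − 2 log(1 − ∑_{i=1}^d x_i). -/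
open Real Filter MeasureTheory
open scoped Matrix

noncomputable section

section Determinants

open scoped MatrixOrder ComplexOrder Matrix.Norms.L2Operator

theorem one_le_det_of_posSemidef_sub_one {n : Type*} [Fintype n] [DecidableEq n]
    {C : Matrix n n ℝ} (h : (C - 1).PosSemidef) : 1 ≤ C.det := by
  have hC : C.IsHermitian := by simpa using h.isHermitian.add Matrix.isHermitian_one
  rw [hC.det_eq_prod_eigenvalues]
  refine Finset.one_le_prod fun i _ => ?_
  have hv := h.dotProduct_mulVec_nonneg (hC.eigenvectorBasis i)
  have hnorm : star ⇑(hC.eigenvectorBasis i) ⬝ᵥ ⇑(hC.eigenvectorBasis i) = (1 : ℝ) := by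
    have := hC.eigenvectorBasis.orthonormal.1 i
    rw [dotProduct_comm, ← EuclideanSpace.inner_eq_star_dotProduct,
      real_inner_self_eq_norm_sq, this, one_pow]
  rw [Matrix.sub_mulVec, Matrix.one_mulVec, dotProduct_sub, hnorm] at hv
  have := hC.eigenvalues_eq i
  simp only [RCLike.re_to_real] at this
  simp only [RCLike.ofReal_real_eq_id, id]
  linarith

theorem det_le_det_of_posSemidef_sub {n : Type*} [Fintype n] [DecidableEq n]
    {A B : Matrix n n ℝ} (hA : A.PosDef) (h : (B - A).PosSemidef) : A.det ≤ B.det := by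
  obtain ⟨S, hS, rfl⟩ := CStarAlgebra.isStrictlyPositive_iff_eq_star_mul_self.mp
    hA.isStrictlyPositive
  rw [Matrix.isUnit_iff_isUnit_det] at hS
  have hinv : S * S⁻¹ = 1 := Matrix.mul_nonsing_inv S hS
  have h1 : ((S⁻¹)ᴴ * B * S⁻¹ - 1).PosSemidef := by
    have hid : (S⁻¹)ᴴ * (star S * S) * S⁻¹ = 1 := by
      rw [Matrix.star_eq_conjTranspose, Matrix.mul_assoc, Matrix.mul_assoc, hinv, mul_one,
        ← Matrix.conjTranspose_mul, hinv, Matrix.conjTranspose_one]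
    have := h.conjTranspose_mul_mul_same S⁻¹
    rwa [mul_sub, sub_mul, hid] at this
  have h2 := one_le_det_of_posSemidef_sub_one h1
  have hd : S.det ≠ 0 := hS.ne_zero
  rw [Matrix.det_mul, Matrix.det_mul, Matrix.det_conjTranspose, star_trivial,
    Matrix.det_nonsing_inv, Ring.inverse_eq_inv'] at h2
  rw [Matrix.star_eq_conjTranspose, Matrix.det_mul, Matrix.det_conjTranspose, star_trivial]
  calc S.det * S.det = S.det * S.det * 1 := (mul_one _).symm
    _ ≤ S.det * S.det * (S.det⁻¹ * B.det * S.det⁻¹) :=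
      mul_le_mul_of_nonneg_left h2 (mul_self_nonneg _)
    _ = B.det := by field_simp

theorem det_diagonal_add_const {n : Type*} [Fintype n] [DecidableEq n] (a : n → ℝ) (c : ℝ)
    (ha : ∀ i, a i ≠ 0) :
    (Matrix.diagonal a + Matrix.of fun _ _ => c).det = (∏ i, a i) * (1 + c * ∑ i, (a i)⁻¹) := by
  have hfac : Matrix.diagonal a + Matrix.of (fun _ _ => c) = Matrix.diagonal a *
      (1 + Matrix.replicateCol Unit (fun i => (a i)⁻¹) * Matrix.replicateRow Unit fun _ => c) := by
    ext i j
    rw [mul_add, mul_one, Matrix.add_apply, Matrix.add_apply, Matrix.diagonal_mul]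
    simp [Matrix.mul_apply, ha i]
  rw [hfac, Matrix.det_mul, Matrix.det_diagonal, Matrix.det_one_add_replicateCol_mul_replicateRow]
  simp [dotProduct, Finset.mul_sum]

end Determinants

section Extrema

theorem deriv_deriv_nonneg_of_isLocalMin {f : ℝ → ℝ} {a : ℝ} (h : IsLocalMin f a)
    (hc : ContinuousAt f a) : 0 ≤ deriv (deriv f) a := by
  by_contra! hneg
  have hmax : IsLocalMax f a := isLocalMax_of_deriv_deriv_neg hneg h.deriv_eq_zero hc
  have hconst : f =ᶠ[nhds a] fun _ => f a := by
    filter_upwards [h, hmax] with y h1 h2 using le_antisymm h2 h1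
  have : deriv (deriv f) a = 0 := by
    rw [hconst.deriv.deriv_eq]
    simp
  linarith

theorem exists_isMinOn_of_tendsto_frontier {E : Type*} [PseudoMetricSpace E] [ProperSpace E]
    {U : Set E} (hU : IsOpen U) (hb : Bornology.IsBounded U) (hne : U.Nonempty) {f : E → ℝ}
    (hf : ContinuousOn f U) (hbd : ∀ x ∈ frontier U, Tendsto f (nhdsWithin x U) atTop) :
    ∃ x ∈ U, IsMinOn f U x := by
  obtain ⟨x₀, hx₀⟩ := hne
  set K := {x ∈ U | f x ≤ f x₀} with hK
  have hKU : K ⊆ U := fun x hx => hx.1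
  have hclosed : IsClosed K := by
    refine isClosed_of_closure_subset fun x hx => ?_
    have hneBot : (nhdsWithin x K).NeBot := mem_closure_iff_nhdsWithin_neBot.mp hx
    by_cases hxU : x ∈ U
    · refine ⟨hxU, le_of_tendsto ((hf x hxU).mono_left (nhdsWithin_mono x hKU)) ?_⟩
      filter_upwards [self_mem_nhdsWithin] with y hy using hy.2
    · have hfr : x ∈ frontier U := by
        rw [hU.frontier_eq]
        exact ⟨closure_mono hKU hx, hxU⟩
      have h1 := ((hbd x hfr).mono_left (nhdsWithin_mono x hKU)).eventually_gt_atTop (f x₀)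
      obtain ⟨y, hy1, hy2⟩ := (h1.and self_mem_nhdsWithin).exists
      exact absurd hy2.2 (not_le.mpr hy1)
  have hcomp : IsCompact K := Metric.isCompact_of_isClosed_isBounded hclosed (hb.subset hKU)
  obtain ⟨x, hxK, hx⟩ := hcomp.exists_isMinOn ⟨x₀, hx₀, le_rfl⟩ (hf.mono hKU)
  refine ⟨x, hKU hxK, fun y hy => ?_⟩
  by_cases hyx : f y ≤ f x₀
  · exact hx ⟨hy, hyx⟩
  · exact hxK.2.trans (not_le.mp hyx).le

theorem continuousLinearMap_apply_eq_sum {d : ℕ} (L : (Fin d → ℝ) →L[ℝ] ℝ) (v : Fin d → ℝ) :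
    L v = ∑ i, v i * L (Pi.single i 1) := by
  conv_lhs => rw [pi_eq_sum_univ' v, map_sum]
  simp [Pi.single]

theorem differentiableAt_fderiv_apply {d : ℕ} {f : (Fin d → ℝ) → ℝ} {x : Fin d → ℝ}
    (hf : ContDiffAt ℝ 2 f x) (v : Fin d → ℝ) :
    DifferentiableAt ℝ (fun y => fderiv ℝ f y v) x :=
  ((hf.fderiv_right (m := 1) (by norm_num)).differentiableAt (by norm_num)).clm_apply
    (differentiableAt_const v)

theorem hess_sub {d : ℕ} {f h : (Fin d → ℝ) → ℝ} {x : Fin d → ℝ}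
    (hf : ContDiffAt ℝ 2 f x) (hh : ContDiffAt ℝ 2 h x) :
    hess d (fun y => f y - h y) x = hess d f x - hess d h x := by
  ext i j
  have hfe : ∀ᶠ y in nhds x, DifferentiableAt ℝ f y :=
    (hf.eventually (by simp)).mono fun y hy => hy.differentiableAt (by norm_num)
  have hhe : ∀ᶠ y in nhds x, DifferentiableAt ℝ h y :=
    (hh.eventually (by simp)).mono fun y hy => hy.differentiableAt (by norm_num)
  have heq : (fun y => fderiv ℝ (fun y => f y - h y) y (Pi.single j 1)) =ᶠ[nhds x]
      fun y => fderiv ℝ f y (Pi.single j 1) - fderiv ℝ h y (Pi.single j 1) := by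
    filter_upwards [hfe, hhe] with y h1 h2
    rw [fderiv_fun_sub h1 h2]
    rfl
  simp only [hess, Matrix.of_apply, Matrix.sub_apply]
  rw [heq.fderiv_eq, fderiv_fun_sub (differentiableAt_fderiv_apply hf _)
    (differentiableAt_fderiv_apply hh _)]
  rfl

theorem dotProduct_hess_mulVec_eq_deriv_deriv {d : ℕ} {f : (Fin d → ℝ) → ℝ} {x : Fin d → ℝ}
    (hf : ContDiffAt ℝ 2 f x) (v : Fin d → ℝ) :
    v ⬝ᵥ (hess d f x *ᵥ v) = deriv (deriv fun s : ℝ => f (x + s • v)) 0 := by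
  have hline : ∀ s : ℝ, HasDerivAt (fun s : ℝ => x + s • v) v s := fun s => by
    simpa using ((hasDerivAt_id s).smul_const v).const_add x
  have hlim : Tendsto (fun s : ℝ => x + s • v) (nhds 0) (nhds x) := by
    simpa using (hline 0).continuousAt.tendsto
  have hfe : ∀ᶠ y in nhds x, DifferentiableAt ℝ f y :=
    (hf.eventually (by simp)).mono fun y hy => hy.differentiableAt (by norm_num)
  have hderiv : deriv (fun s : ℝ => f (x + s • v)) =ᶠ[nhds 0]
      fun s => ∑ j, v j * fderiv ℝ f (x + s • v) (Pi.single j 1) := by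
    filter_upwards [hlim.eventually hfe] with s hs
    rw [← continuousLinearMap_apply_eq_sum]
    exact (hs.hasFDerivAt.comp_hasDerivAt s (hline s)).deriv
  have hterm : ∀ j, HasDerivAt (fun s : ℝ => fderiv ℝ f (x + s • v) (Pi.single j 1))
      (fderiv ℝ (fun y => fderiv ℝ f y (Pi.single j 1)) x v) 0 := fun j => by
    have hd : DifferentiableAt ℝ (fun y => fderiv ℝ f y (Pi.single j 1)) (x + (0 : ℝ) • v) := by
      simpa using differentiableAt_fderiv_apply hf _
    have h1 := hd.hasFDerivAt.comp_hasDerivAt 0 (hline 0)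
    rwa [zero_smul, add_zero] at h1
  rw [hderiv.deriv_eq, (HasDerivAt.fun_sum fun j _ => (hterm j).const_mul (v j)).deriv]
  simp only [dotProduct, Matrix.mulVec, hess, Matrix.of_apply, Finset.mul_sum]
  rw [Finset.sum_comm]
  refine Finset.sum_congr rfl fun j _ => ?_
  rw [continuousLinearMap_apply_eq_sum, Finset.mul_sum]
  exact Finset.sum_congr rfl fun i _ => by ring

theorem posSemidef_hess_sub_of_isLocalMin {d : ℕ} {f h : (Fin d → ℝ) → ℝ} {x : Fin d → ℝ}
    (hf : ContDiffAt ℝ 2 f x) (hh : ContDiffAt ℝ 2 h x) (hfH : (hess d f x).IsHermitian)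
    (hhH : (hess d h x).IsHermitian) (hmin : IsLocalMin (fun y => f y - h y) x) :
    (hess d f x - hess d h x).PosSemidef := by
  refine .of_dotProduct_mulVec_nonneg (hfH.sub hhH) fun v => ?_
  rw [star_trivial, ← hess_sub hf hh, dotProduct_hess_mulVec_eq_deriv_deriv (hf.sub hh)]
  have hline : ContinuousAt (fun s : ℝ => x + s • v) 0 := by fun_prop
  have hx : x + (0 : ℝ) • v = x := by simp
  refine deriv_deriv_nonneg_of_isLocalMin ?_ ?_
  · have hlim : Tendsto (fun s : ℝ => x + s • v) (nhds 0) (nhds x) := by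
      simpa [ContinuousAt] using hline
    filter_upwards [hlim.eventually hmin] with s hs
    simpa using hs
  · refine ContinuousAt.comp (g := fun y => f y - h y) (f := fun s : ℝ => x + s • v) ?_ hline
    rw [hx]
    exact (hf.sub hh).continuousAt

end Extrema

section Barrier

/-- The simplex obtained from `simplexΔ d` by moving every facet outwards by `t`. -/
def shiftedSimplex (d : ℕ) (t : ℝ) : Set (Fin d → ℝ) :=
  {x | (∀ i, 0 < x i + t) ∧ 0 < 1 - ∑ i, x i + t}

/-- The logarithmic barrier of `shiftedSimplex d t`. -/
def shiftedBarrier (d : ℕ) (t : ℝ) (x : Fin d → ℝ) : ℝ :=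
  -2 * ∑ i, Real.log (x i + t) - 2 * Real.log (1 - ∑ i, x i + t)

variable {d : ℕ} {s t : ℝ} {x : Fin d → ℝ}

theorem shiftedSimplex_zero (d : ℕ) : shiftedSimplex d 0 = simplexΔ d := by
  ext x
  simp [shiftedSimplex, simplexΔ]

theorem shiftedBarrier_zero (d : ℕ) : shiftedBarrier d 0 = wbar d := by
  ext x
  simp [shiftedBarrier, wbar]

theorem isOpen_shiftedSimplex (d : ℕ) (t : ℝ) : IsOpen (shiftedSimplex d t) := by
  simp only [shiftedSimplex, Set.ofPred_and, Set.ofPred_forall]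
  refine (isOpen_iInter_of_finite fun i => ?_).inter ?_
  · exact isOpen_lt (by fun_prop) (by fun_prop)
  · exact isOpen_lt (by fun_prop) (by fun_prop)

theorem closure_shiftedSimplex_subset (d : ℕ) (t : ℝ) :
    closure (shiftedSimplex d t) ⊆ {x | (∀ i, 0 ≤ x i + t) ∧ 0 ≤ 1 - ∑ i, x i + t} := by
  refine closure_minimal (fun x hx => ⟨fun i => (hx.1 i).le, hx.2.le⟩) ?_
  simp only [Set.ofPred_and, Set.ofPred_forall]
  refine (isClosed_iInter fun i => ?_).inter ?_
  · exact isClosed_le (by fun_prop) (by fun_prop)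
  · exact isClosed_le (by fun_prop) (by fun_prop)

theorem closure_shiftedSimplex_subset_of_lt (hst : s < t) :
    closure (shiftedSimplex d s) ⊆ shiftedSimplex d t := fun x hx => by
  obtain ⟨h1, h2⟩ := closure_shiftedSimplex_subset d s hx
  exact ⟨fun i => by linarith [h1 i], by linarith⟩

theorem isBounded_simplexΔ (d : ℕ) : Bornology.IsBounded (simplexΔ d) := by
  refine (Metric.isBounded_Icc (0 : Fin d → ℝ) 1).subset fun x hx => ⟨fun i => (hx.1 i).le, ?_⟩
  exact fun i => (Finset.single_le_sum (fun j _ => (hx.1 j).le) (Finset.mem_univ i)).trans hx.2.le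

theorem add_le_one_of_mem_shiftedSimplex (ht : t ≤ 0) (hx : x ∈ shiftedSimplex d t) :
    (∀ i, x i + t ≤ 1) ∧ 1 - ∑ i, x i + t ≤ 1 := by
  have hnn : ∀ i, 0 ≤ x i := fun i => by linarith [hx.1 i]
  have hsum : 0 ≤ ∑ i, x i := Finset.sum_nonneg fun i _ => hnn i
  refine ⟨fun i => ?_, by linarith⟩
  have h1 := Finset.single_le_sum (fun j _ => hnn j) (Finset.mem_univ i)
  linarith [hx.2]

theorem contDiffAt_shiftedBarrier (hx : x ∈ shiftedSimplex d t) :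
    ContDiffAt ℝ 2 (shiftedBarrier d t) x := by
  unfold shiftedBarrier
  refine (contDiffAt_const.mul (ContDiffAt.sum fun i _ => ?_)).sub (contDiffAt_const.mul ?_)
  · exact ContDiffAt.log (by fun_prop) (hx.1 i).ne'
  · exact ContDiffAt.log (by fun_prop) hx.2.ne'

theorem fderiv_shiftedBarrier_single (hx : x ∈ shiftedSimplex d t) (j : Fin d) :
    fderiv ℝ (shiftedBarrier d t) x (Pi.single j 1) =
      2 * (1 - ∑ i, x i + t)⁻¹ - 2 * (x j + t)⁻¹ := by
  have hcoord : ∀ i, HasFDerivAt (fun y : Fin d → ℝ => y i + t)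
      (ContinuousLinearMap.proj (R := ℝ) i) x :=
    fun i => (hasFDerivAt_apply i x).add_const t
  have hslack : HasFDerivAt (fun y : Fin d → ℝ => 1 - ∑ i, y i + t)
      (-∑ i, ContinuousLinearMap.proj (R := ℝ) (φ := fun _ : Fin d => ℝ) i) x :=
    ((HasFDerivAt.fun_sum fun i _ => hasFDerivAt_apply i x).const_sub 1).add_const t
  have h := ((HasFDerivAt.fun_sum fun i (_ : i ∈ Finset.univ) =>
    (hcoord i).log (hx.1 i).ne').const_mul (-2)).sub ((hslack.log hx.2.ne').const_mul 2)
  have h' : HasFDerivAt (shiftedBarrier d t) _ x := h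
  rw [h'.fderiv]
  simp [Pi.single_apply]
  ring

theorem hess_shiftedBarrier (hx : x ∈ shiftedSimplex d t) :
    hess d (shiftedBarrier d t) x =
      Matrix.diagonal (fun i => 2 * ((x i + t) ^ 2)⁻¹) +
        Matrix.of fun _ _ => 2 * ((1 - ∑ i, x i + t) ^ 2)⁻¹ := by
  ext i j
  have heq : (fun y => fderiv ℝ (shiftedBarrier d t) y (Pi.single j 1)) =ᶠ[nhds x]
      fun y => 2 * (1 - ∑ i, y i + t)⁻¹ - 2 * (y j + t)⁻¹ := by
    filter_upwards [(isOpen_shiftedSimplex d t).mem_nhds hx] with y hy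
    exact fderiv_shiftedBarrier_single hy j
  have hcoord : HasFDerivAt (fun y : Fin d → ℝ => y j + t)
      (ContinuousLinearMap.proj (R := ℝ) j) x :=
    (hasFDerivAt_apply j x).add_const t
  have hslack : HasFDerivAt (fun y : Fin d → ℝ => 1 - ∑ i, y i + t)
      (-∑ i, ContinuousLinearMap.proj (R := ℝ) (φ := fun _ : Fin d => ℝ) i) x :=
    ((HasFDerivAt.fun_sum fun i _ => hasFDerivAt_apply i x).const_sub 1).add_const t
  have h := (((hasDerivAt_inv hx.2.ne').comp_hasFDerivAt x hslack).const_mul 2).sub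
    (((hasDerivAt_inv (hx.1 j).ne').comp_hasFDerivAt x hcoord).const_mul 2)
  have h' : HasFDerivAt (fun y : Fin d → ℝ => 2 * (1 - ∑ i, y i + t)⁻¹ - 2 * (y j + t)⁻¹) _ x := h
  simp only [hess, Matrix.of_apply, Matrix.add_apply]
  rw [heq.fderiv_eq, h'.fderiv]
  by_cases hij : i = j
  · subst hij
    simp
    ring
  · simp [hij, Pi.single_apply, Ne.symm hij]

theorem posDef_hess_shiftedBarrier (hx : x ∈ shiftedSimplex d t) :
    (hess d (shiftedBarrier d t) x).PosDef := by
  rw [hess_shiftedBarrier hx]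
  refine Matrix.PosDef.add_posSemidef (.diagonal fun i => ?_) ?_
  · have := hx.1 i
    positivity
  · have h := (Matrix.posSemidef_vecMulVec_self_star (fun _ : Fin d => (1 : ℝ))).smul
      (show (0 : ℝ) ≤ 2 * ((1 - ∑ i, x i + t) ^ 2)⁻¹ by positivity)
    convert h using 1
    ext i j
    simp [Matrix.vecMulVec_apply]

theorem log_det_hess_shiftedBarrier (hx : x ∈ shiftedSimplex d t) :
    Real.log ((2 : ℝ)⁻¹ • hess d (shiftedBarrier d t) x).det =
      shiftedBarrier d t x +
        Real.log (∑ i, (x i + t) ^ 2 + (1 - ∑ i, x i + t) ^ 2) := by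
  have hne : ∀ i, (x i + t) ^ 2 ≠ 0 := fun i => pow_ne_zero 2 (hx.1 i).ne'
  have hne0 : (1 - ∑ i, x i + t) ^ 2 ≠ 0 := pow_ne_zero 2 hx.2.ne'
  have hpos : 0 < ∑ i, (x i + t) ^ 2 + (1 - ∑ i, x i + t) ^ 2 :=
    add_pos_of_nonneg_of_pos (Finset.sum_nonneg fun i _ => sq_nonneg _) (pow_pos hx.2 2)
  have hmat : (2 : ℝ)⁻¹ • hess d (shiftedBarrier d t) x =
      Matrix.diagonal (fun i => ((x i + t) ^ 2)⁻¹) +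
        Matrix.of fun _ _ => ((1 - ∑ i, x i + t) ^ 2)⁻¹ := by
    rw [hess_shiftedBarrier hx]
    ext i j
    by_cases hij : i = j
    · subst hij
      simp
      ring
    · simp [hij]
  have hdet : ((2 : ℝ)⁻¹ • hess d (shiftedBarrier d t) x).det =
      (∏ i, ((x i + t) ^ 2)⁻¹) * (((1 - ∑ i, x i + t) ^ 2)⁻¹ *
        (∑ i, (x i + t) ^ 2 + (1 - ∑ i, x i + t) ^ 2)) := by
    rw [hmat, det_diagonal_add_const _ _ fun i => inv_ne_zero (hne i)]
    simp only [inv_inv]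
    rw [mul_add _ (∑ i, (x i + t) ^ 2), inv_mul_cancel₀ hne0, add_comm (1 : ℝ)]
  rw [hdet, Real.log_mul (Finset.prod_ne_zero_iff.mpr fun i _ => inv_ne_zero (hne i))
    (mul_ne_zero (inv_ne_zero hne0) hpos.ne'), Real.log_mul (inv_ne_zero hne0) hpos.ne',
    Real.log_prod fun i _ => inv_ne_zero (hne i)]
  simp only [Real.log_inv, Real.log_pow, shiftedBarrier, Finset.mul_sum]
  push_cast
  simp only [neg_mul]
  ring

theorem sum_sq_le_one_of_mem_shiftedSimplex (ht : t ≤ 0) (hx : x ∈ shiftedSimplex d t) :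
    ∑ i, (x i + t) ^ 2 + (1 - ∑ i, x i + t) ^ 2 ≤ 1 := by
  obtain ⟨h1, h2⟩ := add_le_one_of_mem_shiftedSimplex ht hx
  have hsum : ∑ i, (x i + t) ^ 2 ≤ ∑ i, x i :=
    Finset.sum_le_sum fun i _ => by nlinarith [hx.1 i, h1 i]
  nlinarith [hx.2]

theorem inv_le_sum_sq (ht : 0 ≤ t) :
    ((d : ℝ) + 1)⁻¹ ≤ ∑ i, (x i + t) ^ 2 + (1 - ∑ i, x i + t) ^ 2 := by
  set c : ℝ := ((d : ℝ) + 1)⁻¹ with hc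
  have hc0 : 0 < c := by positivity
  have hcd : c * (d + 1) = 1 := inv_mul_cancel₀ (by positivity)
  have hterm : ∀ y : ℝ, 2 * c * (y + t) - c ^ 2 ≤ (y + t) ^ 2 := fun y => by
    nlinarith [sq_nonneg (y + t - c)]
  have hsum : ∑ i, (2 * c * (x i + t) - c ^ 2) ≤ ∑ i, (x i + t) ^ 2 :=
    Finset.sum_le_sum fun i _ => hterm (x i)
  rw [Finset.sum_sub_distrib, ← Finset.mul_sum, Finset.sum_add_distrib] at hsum
  simp only [Finset.sum_const, Finset.card_univ, Fintype.card_fin, nsmul_eq_mul] at hsum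
  have h0 := hterm (1 - ∑ i, x i)
  have hct : 0 ≤ c * t := by positivity
  have hd0 : 0 ≤ (d : ℝ) * (c * t) := by positivity
  have hsq : (d : ℝ) * c ^ 2 + c ^ 2 = c := by linear_combination c * hcd
  linarith

theorem tendsto_shiftedBarrier_frontier (ht : t ≤ 0) (hx : x ∈ frontier (shiftedSimplex d t)) :
    Tendsto (shiftedBarrier d t) (nhdsWithin x (shiftedSimplex d t)) atTop := by
  rw [(isOpen_shiftedSimplex d t).frontier_eq] at hx
  obtain ⟨hcl, hnot⟩ := hx
  obtain ⟨h1, h2⟩ := closure_shiftedSimplex_subset d t hcl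
  have key : ∀ l : (Fin d → ℝ) → ℝ, ContinuousAt l x → l x = 0 →
      (∀ y ∈ shiftedSimplex d t, 0 < l y) →
      (∀ y ∈ shiftedSimplex d t, -2 * Real.log (l y) ≤ shiftedBarrier d t y) →
      Tendsto (shiftedBarrier d t) (nhdsWithin x (shiftedSimplex d t)) atTop := by
    intro l hl hlx hlpos hle
    have hlim : Tendsto l (nhdsWithin x (shiftedSimplex d t)) (nhdsWithin 0 (Set.Ioi 0)) := by
      refine tendsto_nhdsWithin_iff.mpr ⟨?_, ?_⟩
      · rw [← hlx]
        exact hl.tendsto.mono_left nhdsWithin_le_nhds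
      · filter_upwards [self_mem_nhdsWithin] with y hy using hlpos y hy
    refine tendsto_atTop_mono' _ ?_ ((Real.tendsto_log_nhdsGT_zero.comp hlim).const_mul_atBot_of_neg
      (show (-2 : ℝ) < 0 by norm_num))
    filter_upwards [self_mem_nhdsWithin] with y hy using hle y hy
  have hlog : ∀ y ∈ shiftedSimplex d t, (∀ i, Real.log (y i + t) ≤ 0) ∧
      Real.log (1 - ∑ i, y i + t) ≤ 0 := fun y hy => by
    obtain ⟨ha, hb⟩ := add_le_one_of_mem_shiftedSimplex ht hy
    exact ⟨fun i => Real.log_nonpos (hy.1 i).le (ha i), Real.log_nonpos hy.2.le hb⟩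
  by_cases hz : ∃ i, x i + t = 0
  · obtain ⟨i, hi⟩ := hz
    have hcont : Continuous fun y : Fin d → ℝ => y i + t :=
      (continuous_apply i).add continuous_const
    refine key (fun y => y i + t) hcont.continuousAt hi (fun y hy => hy.1 i) fun y hy => ?_
    have hs : -∑ j, Real.log (y j + t) ≥ -Real.log (y i + t) := by
      rw [← Finset.sum_neg_distrib]
      exact Finset.single_le_sum (f := fun j => -Real.log (y j + t))
        (fun j _ => neg_nonneg.mpr ((hlog y hy).1 j)) (Finset.mem_univ i)
    unfold shiftedBarrier
    linarith [(hlog y hy).2]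
  · push Not at hz
    have h0 : 1 - ∑ i, x i + t = 0 := by
      by_contra hne
      exact hnot ⟨fun i => lt_of_le_of_ne (h1 i) (hz i).symm, lt_of_le_of_ne h2 (Ne.symm hne)⟩
    refine key (fun y => 1 - ∑ i, y i + t) (by fun_prop) h0 (fun y hy => hy.2) fun y hy => ?_
    have hs : ∑ j, Real.log (y j + t) ≤ 0 := Finset.sum_nonpos fun j _ => (hlog y hy).1 j
    unfold shiftedBarrier
    linarith

theorem tendsto_shiftedBarrier_zero (hx : x ∈ simplexΔ d) :
    Tendsto (fun t => shiftedBarrier d t x) (nhds 0) (nhds (wbar d x)) := by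
  have h : ContinuousAt (fun t => shiftedBarrier d t x) 0 := by
    rw [← shiftedSimplex_zero] at hx
    unfold shiftedBarrier
    refine (continuousAt_const.mul (tendsto_finsetSum _ fun i _ => ?_)).sub
      (continuousAt_const.mul ?_)
    · exact ContinuousAt.log (by fun_prop) (hx.1 i).ne'
    · exact ContinuousAt.log (by fun_prop) hx.2.ne'
  simpa only [ContinuousAt, shiftedBarrier_zero] using h

end Barrier

theorem log_det_le_log_det_of_posSemidef_sub {n : Type*} [Fintype n] [DecidableEq n]
    {A B : Matrix n n ℝ} (hA : A.PosDef) (h : (B - A).PosSemidef) :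
    Real.log ((2 : ℝ)⁻¹ • A).det ≤ Real.log ((2 : ℝ)⁻¹ • B).det := by
  have hA' : ((2 : ℝ)⁻¹ • A).PosDef := hA.smul (by norm_num)
  refine Real.log_le_log hA'.det_pos (det_le_det_of_posSemidef_sub hA' ?_)
  rw [← smul_sub]
  exact h.smul (by norm_num)

theorem shiftedBarrier_sub_log_le {d : ℕ} {g : (Fin d → ℝ) → ℝ}
    (hg : ContDiffOn ℝ (⊤ : ℕ∞) g (simplexΔ d))
    (hpos : ∀ x ∈ simplexΔ d, (hess d g x).PosDef)
    (hMA : ∀ x ∈ simplexΔ d, g x = Real.log (((2 : ℝ)⁻¹ • hess d g x).det))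
    (hbd : ∀ x0 ∈ frontier (simplexΔ d), Tendsto g (nhdsWithin x0 (simplexΔ d)) atTop)
    {t : ℝ} (ht : 0 < t) {x : Fin d → ℝ} (hx : x ∈ simplexΔ d) :
    shiftedBarrier d t x - Real.log ((d : ℝ) + 1) ≤ g x := by
  have hopen : IsOpen (simplexΔ d) := shiftedSimplex_zero d ▸ isOpen_shiftedSimplex d 0
  have hcl : closure (simplexΔ d) ⊆ shiftedSimplex d t :=
    shiftedSimplex_zero d ▸ closure_shiftedSimplex_subset_of_lt ht
  obtain ⟨z, hz, hmin⟩ := exists_isMinOn_of_tendsto_frontier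
    (f := fun y => g y - shiftedBarrier d t y) hopen (isBounded_simplexΔ d) ⟨x, hx⟩
    (hg.continuousOn.sub fun y hy =>
      (contDiffAt_shiftedBarrier (hcl (subset_closure hy))).continuousAt.continuousWithinAt)
    fun y hy => by
      have hc := (contDiffAt_shiftedBarrier (hcl hy.1)).continuousAt
      exact (hbd y hy).atTop_add (hc.tendsto.mono_left nhdsWithin_le_nhds).neg
  have hzt := hcl (subset_closure hz)
  have hgz : ContDiffAt ℝ 2 g z :=
    (hg.contDiffAt (hopen.mem_nhds hz)).of_le (WithTop.coe_le_coe.mpr le_top)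
  have hpd := posDef_hess_shiftedBarrier hzt
  have hpsd := posSemidef_hess_sub_of_isLocalMin hgz (contDiffAt_shiftedBarrier hzt)
    (hpos z hz).isHermitian hpd.isHermitian (hmin.isLocalMin (hopen.mem_nhds hz))
  have hdet := log_det_le_log_det_of_posSemidef_sub hpd hpsd
  rw [← hMA z hz, log_det_hess_shiftedBarrier hzt] at hdet
  have hlog := Real.log_le_log (by positivity) (inv_le_sum_sq (x := z) ht.le)
  rw [Real.log_inv] at hlog
  have hxz : g z - shiftedBarrier d t z ≤ g x - shiftedBarrier d t x := hmin hx
  linarith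

theorem le_shiftedBarrier {d : ℕ} {g : (Fin d → ℝ) → ℝ}
    (hg : ContDiffOn ℝ (⊤ : ℕ∞) g (simplexΔ d))
    (hpos : ∀ x ∈ simplexΔ d, (hess d g x).PosDef)
    (hMA : ∀ x ∈ simplexΔ d, g x = Real.log (((2 : ℝ)⁻¹ • hess d g x).det))
    {t : ℝ} (ht : t < 0) {x : Fin d → ℝ} (hx : x ∈ shiftedSimplex d t) :
    g x ≤ shiftedBarrier d t x := by
  have hopen : IsOpen (simplexΔ d) := shiftedSimplex_zero d ▸ isOpen_shiftedSimplex d 0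
  have hopen' := isOpen_shiftedSimplex d t
  have hcl : closure (shiftedSimplex d t) ⊆ simplexΔ d :=
    shiftedSimplex_zero d ▸ closure_shiftedSimplex_subset_of_lt ht
  have hsub : shiftedSimplex d t ⊆ simplexΔ d := subset_closure.trans hcl
  obtain ⟨z, hz, hmin⟩ := exists_isMinOn_of_tendsto_frontier
    (f := fun y => shiftedBarrier d t y - g y) hopen' ((isBounded_simplexΔ d).subset hsub) ⟨x, hx⟩
    (ContinuousOn.sub (fun y hy =>
      (contDiffAt_shiftedBarrier hy).continuousAt.continuousWithinAt) (hg.continuousOn.mono hsub))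
    fun y hy => by
      have hc := hg.continuousOn.continuousAt (hopen.mem_nhds (hcl hy.1))
      exact (tendsto_shiftedBarrier_frontier ht.le hy).atTop_add
        (hc.tendsto.mono_left nhdsWithin_le_nhds).neg
  have hgz : ContDiffAt ℝ 2 g z :=
    (hg.contDiffAt (hopen.mem_nhds (hsub hz))).of_le (WithTop.coe_le_coe.mpr le_top)
  have hpd := hpos z (hsub hz)
  have hpsd := posSemidef_hess_sub_of_isLocalMin (contDiffAt_shiftedBarrier hz) hgz
    (posDef_hess_shiftedBarrier hz).isHermitian hpd.isHermitian
    (hmin.isLocalMin (hopen'.mem_nhds hz))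
  have hdet := log_det_le_log_det_of_posSemidef_sub hpd hpsd
  rw [← hMA z (hsub hz), log_det_hess_shiftedBarrier hz] at hdet
  have hlog := Real.log_nonpos (by positivity) (sum_sq_le_one_of_mem_shiftedSimplex ht.le hz)
  have hxz : shiftedBarrier d t z - g z ≤ shiftedBarrier d t x - g x := hmin hx
  linarith

/-- Barrier bounds for the solution of the Monge–Ampère equation on the simplex:
`w - log(d+1) ≤ g ≤ w`. -/
theorem MA_solution_barrier_bounds (d : ℕ) (hd : 1 ≤ d) (g : (Fin d → ℝ) → ℝ)
    (hg : ContDiffOn ℝ (⊤ : ℕ∞) g (simplexΔ d))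
    (hpos : ∀ x ∈ simplexΔ d, (hess d g x).PosDef)
    (hMA : ∀ x ∈ simplexΔ d, g x = Real.log (((2 : ℝ)⁻¹ • hess d g x).det))
    (hbd : ∀ x0 ∈ frontier (simplexΔ d),
      Filter.Tendsto g (nhdsWithin x0 (simplexΔ d)) Filter.atTop) :
    ∀ x ∈ simplexΔ d,
      wbar d x - Real.log ((d : ℝ) + 1) ≤ g x ∧ g x ≤ wbar d x := by
  intro x hx
  constructor
  · refine le_of_tendsto (((tendsto_shiftedBarrier_zero hx).sub_const _).mono_left
      (nhdsWithin_le_nhds (s := Set.Ioi 0))) ?_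
    filter_upwards [self_mem_nhdsWithin] with t ht
    exact shiftedBarrier_sub_log_le hg hpos hMA hbd ht hx
  · refine ge_of_tendsto ((tendsto_shiftedBarrier_zero hx).mono_left
      (nhdsWithin_le_nhds (s := Set.Iio 0))) ?_
    have hmem : ∀ᶠ t in nhds (0 : ℝ), x ∈ shiftedSimplex d t := by
      rw [← shiftedSimplex_zero] at hx
      refine (eventually_all.mpr fun i => ?_).and ?_
      · exact ContinuousAt.eventually_lt (by fun_prop) (by fun_prop) (hx.1 i)
      · exact ContinuousAt.eventually_lt (by fun_prop) (by fun_prop) hx.2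
    filter_upwards [self_mem_nhdsWithin, nhdsWithin_le_nhds hmem] with t ht hxt
    exact le_shiftedBarrier hg hpos hMA ht hxt
end
end
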